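/- arXiv:2305.01990 — 6 statements merged into one kernel-verified Lean document; each statement's English description precedes it below -/
import Mathlib

section
/- The pairs of repelling/attracting fixed points of hyperbolic elements of SL₂(ℤ) are dense in ℝ × ℝ off the diagonal: for any nonempty open subsets U, V of ℝ with U ∩ V = ∅, there exist a matrix q = ((a,b),(c,d)) ∈ SL₂(ℤ) with |a+d| > 2 and real numbers ξ₋ ∈ U and ξ₊ ∈ V such that c·ξ₋ + d ≠ 0, c·ξ₊ + d ≠ 0, (a·ξ₋+b)/(c·ξ₋+d) = ξ₋, (a·ξ₊+b)/(c·ξ₊+d) = ξ₊, and moreover |c·ξ₋+d| < 1 < |c·ξ₊+d| (so that ξ₋ is the repelling and ξ₊ the attracting fixed point of the Möbius transformation of q). -/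
/-- For `t, u, v` with `T = t (v - u)`, the point `u + y (v - u)` is fixed by the product of the
parabolic maps of parameter `t` fixing `u` and `v` as soon as `(T + 2) y (1 - y) = 1`, and the
value of the denominator there is `-y² / (1 - y)²`. -/
lemma parabolic_product_fixed_point {t u v y a b c d : ℝ}
    (ha : a = 1 - t * (u + v) - t ^ 2 * (v - u) * v)
    (hb : b = t * (u ^ 2 + v ^ 2) + t ^ 2 * (v - u) * u * v)
    (hc : c = -2 * t - t ^ 2 * (v - u))
    (hd : d = 1 + t * (u + v) + t ^ 2 * (v - u) * u)
    (hy₀ : 0 < y) (hy₁ : y < 1) (hy : (t * (v - u) + 2) * (y * (1 - y)) = 1) :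
    c * (u + y * (v - u)) + d ≠ 0 ∧
      (a * (u + y * (v - u)) + b) / (c * (u + y * (v - u)) + d) = u + y * (v - u) ∧
      |c * (u + y * (v - u)) + d| = (y / (1 - y)) ^ 2 := by
  have h1 : 0 < 1 - y := by linarith
  have hden : c * (u + y * (v - u)) + d = -(y / (1 - y)) ^ 2 := by
    have : (c * (u + y * (v - u)) + d) * (1 - y) ^ 2 = -y ^ 2 := by
      subst hc hd
      linear_combination (-(t * (v - u)) * (1 - y) - 1) * hy
    field_simp
    linear_combination this
  have hpos : 0 < (y / (1 - y)) ^ 2 := by positivity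
  have hne : c * (u + y * (v - u)) + d ≠ 0 := by
    rw [hden]
    exact neg_ne_zero.mpr hpos.ne'
  refine ⟨hne, ?_, ?_⟩
  · rw [div_eq_iff hne]
    subst ha hb hc hd
    linear_combination (-t * (v - u) ^ 2) * hy
  · rw [hden, abs_neg, abs_of_pos hpos]

/-- Two nonempty open sets of reals contain rationals written over a common denominator. -/
lemma exists_common_denominator {U V : Set ℝ} (hU : IsOpen U) (hV : IsOpen V)
    (hUne : U.Nonempty) (hVne : V.Nonempty) :
    ∃ p r s : ℤ, s ≠ 0 ∧ (p / s : ℝ) ∈ U ∧ (r / s : ℝ) ∈ V := by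
  obtain ⟨x, hx⟩ := Rat.denseRange_cast.exists_mem_open hU hUne
  obtain ⟨z, hz⟩ := Rat.denseRange_cast.exists_mem_open hV hVne
  have hxd : (x.den : ℝ) ≠ 0 := mod_cast x.den_nz
  have hzd : (z.den : ℝ) ≠ 0 := mod_cast z.den_nz
  refine ⟨x.num * z.den, z.num * x.den, x.den * z.den, ?_, ?_, ?_⟩
  · exact mod_cast mul_ne_zero x.den_nz z.den_nz
  · convert hx using 1
    rw [Rat.cast_def]
    push_cast
    field_simp
  · convert hz using 1
    rw [Rat.cast_def]
    push_cast
    field_simp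

lemma exists_int_mul_gt {D : ℝ} (hD : D ≠ 0) (K : ℝ) : ∃ n : ℤ, K < n * D := by
  rcases hD.lt_or_gt with h | h
  · obtain ⟨n, hn⟩ := exists_int_lt (K / D)
    exact ⟨n, (lt_div_iff_of_neg h).mp hn⟩
  · obtain ⟨n, hn⟩ := exists_int_gt (K / D)
    exact ⟨n, (div_lt_iff₀ h).mp hn⟩

/-- Points near `u` on the line through `u` with direction `δ` stay in an open set around `u`. -/
lemma eventually_add_mul_mem {W : Set ℝ} (hW : IsOpen W) {u : ℝ} (hu : u ∈ W) (δ : ℝ) :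
    ∀ᶠ y in nhds (0 : ℝ), u + y * δ ∈ W := by
  have hcont : Continuous fun y : ℝ => u + y * δ := by fun_prop
  exact hcont.continuousAt.eventually_mem (hW.mem_nhds (by simpa using hu))

/-- **Statement 2.** Pairs of repelling/attracting fixed points of hyperbolic elements of
`SL₂(ℤ)` are dense off the diagonal: for any disjoint nonempty open `U, V ⊆ ℝ` there are
`((a,b),(c,d)) ∈ SL₂(ℤ)` with `|a+d| > 2` and fixed points `ξ₋ ∈ U`, `ξ₊ ∈ V` of the
associated Möbius map, with `|c·ξ₋+d| < 1 < |c·ξ₊+d|` (so `ξ₋` is repelling and `ξ₊`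
attracting). -/
theorem dense_hyperbolic_fixed_pairs (U V : Set ℝ) (hU : IsOpen U) (hV : IsOpen V)
    (hUne : U.Nonempty) (hVne : V.Nonempty) (hUV : U ∩ V = ∅) :
    ∃ (a b c d : ℤ) (ξm ξp : ℝ),
      a * d - b * c = 1 ∧ 2 < |a + d| ∧ ξm ∈ U ∧ ξp ∈ V ∧
      (c : ℝ) * ξm + (d : ℝ) ≠ 0 ∧ (c : ℝ) * ξp + (d : ℝ) ≠ 0 ∧
      ((a : ℝ) * ξm + (b : ℝ)) / ((c : ℝ) * ξm + (d : ℝ)) = ξm ∧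
      ((a : ℝ) * ξp + (b : ℝ)) / ((c : ℝ) * ξp + (d : ℝ)) = ξp ∧
      |(c : ℝ) * ξm + (d : ℝ)| < 1 ∧ 1 < |(c : ℝ) * ξp + (d : ℝ)| := by
  obtain ⟨p, r, s, hs, hpU, hrV⟩ := exists_common_denominator hU hV hUne hVne
  have hs' : (s : ℝ) ≠ 0 := mod_cast hs
  obtain ⟨u, hu⟩ : ∃ u : ℝ, u = p / s := ⟨_, rfl⟩
  obtain ⟨v, hv⟩ : ∃ v : ℝ, v = r / s := ⟨_, rfl⟩
  rw [← hu] at hpU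
  rw [← hv] at hrV
  have huv : v - u ≠ 0 := by
    intro h
    have hmem : u ∈ U ∩ V := ⟨hpU, by rwa [← sub_eq_zero.mp h]⟩
    simp [hUV] at hmem
  obtain ⟨ε, hε, hball⟩ := Metric.eventually_nhds_iff.mp
    ((eventually_add_mul_mem hU hpU (v - u)).and (eventually_add_mul_mem hV hrV (-(v - u))))
  obtain ⟨e, he₀, he⟩ := exists_between (lt_min hε (by norm_num : (0 : ℝ) < 1 / 2))
  obtain ⟨heε, he₁⟩ := lt_min_iff.mp he
  have hee : 0 < e * (1 - e) := mul_pos he₀ (by linarith)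
  obtain ⟨n, hn⟩ := exists_int_mul_gt (mul_ne_zero (pow_ne_zero 2 hs') huv) (1 / (e * (1 - e)))
  obtain ⟨t, ht⟩ : ∃ t : ℝ, t = n * s ^ 2 := ⟨_, rfl⟩
  rw [← mul_assoc, ← ht, div_lt_iff₀ hee] at hn
  obtain ⟨y, ⟨hy₀, hye⟩, hy⟩ : ∃ y ∈ Set.Ioo 0 e, (t * (v - u) + 2) * (y * (1 - y)) = 1 := by
    refine intermediate_value_Ioo (f := fun y => (t * (v - u) + 2) * (y * (1 - y))) he₀.le
      (by fun_prop) ⟨by simp, ?_⟩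
    linarith
  have hT : 2 < t * (v - u) := by
    by_contra! h
    have hyy : 0 < y * (1 - y) := mul_pos hy₀ (by linarith)
    nlinarith [mul_pos (sub_pos.mpr (hye.trans he₁)) (sub_pos.mpr (hye.trans he₁))]
  obtain ⟨hmU, hpV⟩ := hball (y := y) (by
    rw [Real.dist_eq, sub_zero, abs_of_pos hy₀]
    linarith)
  obtain ⟨a, ha⟩ : ∃ a : ℤ, a = 1 - n * s * (p + r) - n ^ 2 * s ^ 2 * (r - p) * r := ⟨_, rfl⟩
  obtain ⟨b, hb⟩ : ∃ b : ℤ, b = n * (p ^ 2 + r ^ 2) + n ^ 2 * s * (r - p) * p * r := ⟨_, rfl⟩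
  obtain ⟨c, hc⟩ : ∃ c : ℤ, c = -2 * n * s ^ 2 - n ^ 2 * s ^ 3 * (r - p) := ⟨_, rfl⟩
  obtain ⟨d, hd⟩ : ∃ d : ℤ, d = 1 + n * s * (p + r) + n ^ 2 * s ^ 2 * (r - p) * p := ⟨_, rfl⟩
  have hp : (p : ℝ) = u * s := by rw [hu]; field_simp
  have hr : (r : ℝ) = v * s := by rw [hv]; field_simp
  have ha' : (a : ℝ) = 1 - t * (u + v) - t ^ 2 * (v - u) * v := by
    rw [ha, ht]; push_cast; rw [hp, hr]; ring
  have hb' : (b : ℝ) = t * (u ^ 2 + v ^ 2) + t ^ 2 * (v - u) * u * v := by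
    rw [hb, ht]; push_cast; rw [hp, hr]; ring
  have hc' : (c : ℝ) = -2 * t - t ^ 2 * (v - u) := by
    rw [hc, ht]; push_cast; rw [hp, hr]; ring
  have hd' : (d : ℝ) = 1 + t * (u + v) + t ^ 2 * (v - u) * u := by
    rw [hd, ht]; push_cast; rw [hp, hr]; ring
  obtain ⟨hm₁, hm₂, hm₃⟩ :=
    parabolic_product_fixed_point ha' hb' hc' hd' hy₀ (by linarith) hy
  obtain ⟨hp₁, hp₂, hp₃⟩ :=
    parabolic_product_fixed_point (y := 1 - y) ha' hb' hc' hd' (by linarith) (by linarith)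
      (by linear_combination hy)
  refine ⟨a, b, c, d, u + y * (v - u), u + (1 - y) * (v - u), ?_, ?_, hmU, ?_, hm₁, hp₁, hm₂,
    hp₂, ?_, ?_⟩
  · rw [ha, hb, hc, hd]; ring
  · have htr : (2 : ℝ) < |(a : ℝ) + d| := by
      rw [lt_abs, ha', hd']
      right
      nlinarith
    exact_mod_cast htr
  · convert hpV using 1
    ring
  · rw [hm₃]
    have h1 : 0 < 1 - y := by linarith
    exact pow_lt_one₀ (by positivity) ((div_lt_one h1).mpr (by linarith)) two_ne_zero
  · rw [hp₃]
    have h1 : 0 < 1 - (1 - y) := by linarith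
    exact one_lt_pow₀ ((one_lt_div h1).mpr (by linarith)) two_ne_zero
end

section
/- Let G be a group, H a subgroup of G, and Λ a subgroup of H that has no proper subgroup of finite index. Let g ∈ G be such that gΛg⁻¹ is not contained in H. Then the index of H ∩ gHg⁻¹ in gHg⁻¹ is infinite. -/
/-- **Statement 4.** Let `Λ ≤ H` be subgroups of `G`, where `Λ` has no proper subgroup of
finite index. If `gΛg⁻¹ ⊄ H`, then `H ∩ gHg⁻¹` has infinite index in `gHg⁻¹`.
(In Mathlib, `Subgroup.index = 0` encodes infinite index.) -/
theorem index_infinite_of_conj_not_le {G : Type*} [Group G] (H Λ : Subgroup G)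
    (hΛH : Λ ≤ H) (hΛ : ∀ K : Subgroup Λ, K.index ≠ 0 → K = ⊤)
    (g : G) (hg : ¬ Λ.map (MulAut.conj g).toMonoidHom ≤ H) :
    ((H ⊓ H.map (MulAut.conj g).toMonoidHom).subgroupOf
      (H.map (MulAut.conj g).toMonoidHom)).index = 0 := by
  rw [Subgroup.inf_subgroupOf_right]
  by_contra h
  refine hg (Subgroup.map_le_iff_le_comap.mpr (Subgroup.subgroupOf_eq_top.mp (hΛ _ ?_)))
  change Subgroup.relIndex _ Λ ≠ 0
  rw [Subgroup.relIndex_comap]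
  exact fun h0 => h (Subgroup.relIndex_eq_zero_of_le_right (Subgroup.map_mono hΛH) h0)
end

section
/- Let p be a prime number and T a set of prime numbers with p ∉ T. Let a, b, c, d ∈ ℚ with a·d − b·c = 1. If for infinitely many n ∈ ℕ the rational number b·p^(−2n) + (a−d)·p^(−3n) − c·p^(−4n) lies in ℤ[1/T], then b = 0, c = 0, and a = d with a² = 1 (i.e., the matrix ((a,b),(c,d)) is Id or −Id). -/
/-- The ring `ℤ[1/T]`, as the subring of `ℚ` generated by the inverses of the elements
of `T`. -/
def ZinvQ (T : Set ℕ) : Subring ℚ := Subring.closure {x : ℚ | ∃ p ∈ T, x = (p : ℚ)⁻¹}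

/-- Elements of `ℤ[1/T]` are `p`-adic integers when `p ∉ T`. -/
theorem ZinvQ.padic_norm_le_one {p : ℕ} [Fact p.Prime] {T : Set ℕ} (hT : ∀ q ∈ T, q.Prime)
    (hpT : p ∉ T) {x : ℚ} (hx : x ∈ ZinvQ T) : ‖(x : ℚ_[p])‖ ≤ 1 := by
  have hle : ZinvQ T ≤ (PadicInt.subring p).comap (Rat.castHom ℚ_[p]) := by
    refine Subring.closure_le.2 ?_
    rintro _ ⟨q, hq, rfl⟩
    have hpq : p.Coprime q :=
      (Nat.coprime_primes Fact.out (hT q hq)).2 fun h => hpT (h ▸ hq)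
    change ‖(((q : ℚ)⁻¹ : ℚ) : ℚ_[p])‖ ≤ 1
    simp [Padic.norm_natCast_eq_one_iff.2 hpq]
  exact hle hx

/-- An element whose norm is infinitely often at most `M * ‖r‖ ^ n`, with `‖r‖ < 1`, vanishes. -/
theorem eq_zero_of_frequently_norm_le {K : Type*} [NormedField K] {r y : K} (hr : ‖r‖ < 1)
    (M : ℝ) (h : ∃ᶠ n : ℕ in Filter.atTop, ‖y‖ ≤ M * ‖r ^ n‖) : y = 0 := by
  have hlim : Filter.Tendsto (fun n : ℕ => M * ‖r ^ n‖) Filter.atTop (nhds 0) := by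
    simpa using (tendsto_pow_atTop_nhds_zero_of_lt_one (norm_nonneg r) hr).const_mul M
  by_contra hy
  obtain ⟨n, hn, hn'⟩ := (h.and_eventually (hlim.eventually_lt_const (norm_pos_iff.2 hy))).exists
  exact absurd hn (not_le.2 hn')

/-- If `B t² + E t - C` is infinitely often `t⁴` times an element of the closed unit ball, where
`t = r ^ n` and `‖r‖ < 1`, then all three coefficients vanish. -/
theorem coefficients_eq_zero_of_frequently {K : Type*} [NormedField K] {r B E C : K}
    (hr0 : r ≠ 0) (hr : ‖r‖ < 1)
    (h : ∃ᶠ n : ℕ in Filter.atTop, ∃ x : K, ‖x‖ ≤ 1 ∧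
      B * (r ^ n) ^ 2 + E * r ^ n - C = (r ^ n) ^ 4 * x) :
    B = 0 ∧ E = 0 ∧ C = 0 := by
  have ht0 (n : ℕ) : r ^ n ≠ 0 := pow_ne_zero n hr0
  have ht1 (n : ℕ) : ‖r ^ n‖ ≤ 1 := by
    rw [norm_pow]
    exact pow_le_one₀ (norm_nonneg r) hr.le
  have hpow {k n : ℕ} {x : K} (hx : ‖x‖ ≤ 1) : ‖(r ^ n) ^ k * x‖ ≤ 1 := by
    rw [norm_mul, norm_pow]
    exact mul_le_one₀ (pow_le_one₀ (norm_nonneg _) (ht1 n)) (norm_nonneg x) hx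
  have hC : C = 0 := by
    refine eq_zero_of_frequently_norm_le hr (‖B‖ + ‖E‖ + 1) (h.mono ?_)
    rintro n ⟨x, hx, hn⟩
    have hCn : C = (B * r ^ n + E - (r ^ n) ^ 3 * x) * r ^ n := by linear_combination -hn
    have hBn : ‖B * r ^ n‖ ≤ ‖B‖ := by
      rw [norm_mul]
      exact mul_le_of_le_one_right (norm_nonneg B) (ht1 n)
    rw [congrArg norm hCn, norm_mul]
    gcongr
    exact (norm_sub_le _ _).trans
      (add_le_add ((norm_add_le _ _).trans (add_le_add_left hBn _)) (hpow hx))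
  subst hC
  have hE : E = 0 := by
    refine eq_zero_of_frequently_norm_le hr (1 + ‖B‖) (h.mono ?_)
    rintro n ⟨x, hx, hn⟩
    have hEn : E = ((r ^ n) ^ 2 * x - B) * r ^ n :=
      mul_right_cancel₀ (ht0 n) (by linear_combination hn)
    rw [congrArg norm hEn, norm_mul]
    gcongr
    exact (norm_sub_le _ _).trans (add_le_add_left (hpow hx) _)
  subst hE
  refine ⟨eq_zero_of_frequently_norm_le hr 1 (h.mono ?_), rfl, rfl⟩
  rintro n ⟨x, hx, hn⟩
  have hBn : B = ((r ^ n) ^ 1 * x) * r ^ n :=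
    mul_right_cancel₀ (pow_ne_zero 2 (ht0 n)) (by linear_combination hn)
  rw [congrArg norm hBn, norm_mul]
  gcongr
  exact hpow hx

/-- **Statement 8.** Let `p` be a prime not in the set of primes `T`, and `a,b,c,d ∈ ℚ`
with `a·d − b·c = 1`. If `b·p^(−2n) + (a−d)·p^(−3n) − c·p^(−4n) ∈ ℤ[1/T]` for infinitely
many `n`, then `b = 0`, `c = 0` and `a = d` with `a² = 1`. -/
theorem coefficients_vanish_of_infinitely_many (p : ℕ) (hp : p.Prime)
    (T : Set ℕ) (hT : ∀ q ∈ T, q.Prime) (hpT : p ∉ T)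
    (a b c d : ℚ) (hdet : a * d - b * c = 1)
    (hinf : {n : ℕ | b * (p : ℚ) ^ (-(2 * (n : ℤ))) + (a - d) * (p : ℚ) ^ (-(3 * (n : ℤ)))
      - c * (p : ℚ) ^ (-(4 * (n : ℤ))) ∈ ZinvQ T}.Infinite) :
    b = 0 ∧ c = 0 ∧ a = d ∧ a ^ 2 = 1 := by
  have : Fact p.Prime := ⟨hp⟩
  have hp0 : (p : ℚ) ≠ 0 := Nat.cast_ne_zero.2 hp.ne_zero
  have hfreq : ∃ᶠ n : ℕ in Filter.atTop, ∃ x : ℚ_[p], ‖x‖ ≤ 1 ∧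
      (b : ℚ_[p]) * ((p : ℚ_[p]) ^ n) ^ 2 + ((a - d : ℚ) : ℚ_[p]) * (p : ℚ_[p]) ^ n - (c : ℚ_[p])
        = ((p : ℚ_[p]) ^ n) ^ 4 * x := by
    refine (Nat.frequently_atTop_iff_infinite.2 hinf).mono fun n hn =>
      ⟨_, ZinvQ.padic_norm_le_one hT hpT hn, ?_⟩
    have hz (k : ℕ) : (p : ℚ) ^ (-((k : ℤ) * (n : ℤ))) = (((p : ℚ) ^ n) ^ k)⁻¹ := by
      rw [zpow_neg, mul_comm, zpow_mul, zpow_natCast, zpow_natCast]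
    have h2 := hz 2
    have h3 := hz 3
    have h4 := hz 4
    push_cast at h2 h3 h4
    rw [h2, h3, h4]
    have ht : (p : ℚ) ^ n ≠ 0 := pow_ne_zero n hp0
    have key : b * ((p : ℚ) ^ n) ^ 2 + (a - d) * (p : ℚ) ^ n - c = ((p : ℚ) ^ n) ^ 4 *
        (b * (((p : ℚ) ^ n) ^ 2)⁻¹ + (a - d) * (((p : ℚ) ^ n) ^ 3)⁻¹
          - c * (((p : ℚ) ^ n) ^ 4)⁻¹) := by
      field_simp
    exact_mod_cast congrArg (Rat.cast : ℚ → ℚ_[p]) key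
  obtain ⟨hb, he, hc⟩ := coefficients_eq_zero_of_frequently
    (Nat.cast_ne_zero.2 hp.ne_zero) Padic.norm_p_lt_one hfreq
  rw [Rat.cast_eq_zero] at hb he hc
  obtain rfl : a = d := sub_eq_zero.1 he
  subst hb hc
  exact ⟨rfl, rfl, rfl, by linear_combination hdet⟩
end

section
/- Let Λ be a group and Z an infinite group, and let Γ = Λ ≀ Z be the restricted wreath product. Then the subgroup Λ_e is unconfined in Γ; in fact, for every finite subset E ⊆ Γ with 1 ∉ E there exists z ∈ Z (viewed as an element of Γ) such that z·Λ_e·z⁻¹ ∩ E = ∅. -/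
open scoped Classical

noncomputable section

variable (Λ Z : Type*) [Group Λ] [Group Z]

/-- The base group `B = ⨁_{z ∈ Z} Λ` of the restricted wreath product: finitely
supported functions `Z → Λ`, as a subgroup of the direct product. -/
def Bsub : Subgroup (Z → Λ) where
  carrier := {f | (Function.mulSupport f).Finite}
  one_mem' := by simp [Function.mulSupport_one]
  mul_mem' {f g} hf hg := (hf.union hg).subset (Function.mulSupport_mul f g)
  inv_mem' {f} hf := by simpa [Function.mulSupport_inv] using hf

/-- The shift automorphism of `B` by `z ∈ Z`: `(z·f)(w) = f(z⁻¹·w)`. -/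
def shiftAut (z : Z) : MulAut (Bsub Λ Z) where
  toFun f := ⟨fun w => f.1 (z⁻¹ * w), by
    refine (f.2.image (fun w => z * w)).subset fun x hx => ?_
    exact ⟨z⁻¹ * x, hx, by group⟩⟩
  invFun f := ⟨fun w => f.1 (z * w), by
    refine (f.2.image (fun w => z⁻¹ * w)).subset fun x hx => ?_
    exact ⟨z * x, hx, by group⟩⟩
  left_inv f := Subtype.ext (funext fun w => by simp)
  right_inv f := Subtype.ext (funext fun w => by simp)
  map_mul' f g := Subtype.ext (funext fun w => rfl)

/-- The shift action `Z →* Aut(B)`. -/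
def shiftHom : Z →* MulAut (Bsub Λ Z) where
  toFun := shiftAut Λ Z
  map_one' := MulEquiv.ext fun f => Subtype.ext (funext fun w => by simp [shiftAut])
  map_mul' z₁ z₂ := MulEquiv.ext fun f => Subtype.ext (funext fun w => by
    simp [shiftAut, mul_assoc])

/-- The restricted wreath product `Λ ≀ Z = B ⋊ Z`. -/
abbrev Wr := Bsub Λ Z ⋊[shiftHom Λ Z] Z

/-- The embedding `Λ →* B` at the coordinate `z ∈ Z`. -/
def singleHom (z : Z) : Λ →* Bsub Λ Z where
  toFun l := ⟨fun w => if w = z then l else 1, by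
    refine (Set.finite_singleton z).subset fun w hw => ?_
    by_contra hwz
    simp only [Set.mem_singleton_iff] at hwz
    exact hw (if_neg hwz)⟩
  map_one' := Subtype.ext (funext fun w => by simp)
  map_mul' l₁ l₂ := Subtype.ext (funext fun w => by by_cases h : w = z <;> simp [h])

/-- `Λ_z`: the copy of `Λ` in `Λ ≀ Z` supported at the coordinate `z`. -/
def LambdaAt (z : Z) : Subgroup (Wr Λ Z) :=
  ((SemidirectProduct.inl : Bsub Λ Z →* Wr Λ Z).comp (singleHom Λ Z z)).range

/-- Conjugating `Λ_e` by `z ∈ Z` gives `Λ_z`. -/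
theorem conj_inr_mem_LambdaAt_one_iff (z : Z) (x : Wr Λ Z) :
    (SemidirectProduct.inr z : Wr Λ Z)⁻¹ * x * SemidirectProduct.inr z ∈ LambdaAt Λ Z (1 : Z) ↔
      x ∈ LambdaAt Λ Z z := by
  have shift_single (l : Λ) : shiftHom Λ Z z (singleHom Λ Z 1 l) = singleHom Λ Z z l :=
    Subtype.ext <| funext fun w => by
      simp [shiftHom, shiftAut, singleHom, inv_mul_eq_one, eq_comm]
  simp only [LambdaAt, MonoidHom.mem_range, MonoidHom.comp_apply, ← shift_single,
    SemidirectProduct.inl_aut, map_inv]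
  refine exists_congr fun l => ?_
  rw [mul_inv_eq_iff_eq_mul, mul_assoc, eq_inv_mul_iff_mul_eq]

/-- An element of `Λ_z` whose base component is trivial at `z` is the identity. -/
theorem eq_one_of_mem_LambdaAt {z : Z} {x : Wr Λ Z} (hx : x ∈ LambdaAt Λ Z z)
    (hz : x.left.1 z = 1) : x = 1 := by
  obtain ⟨l, rfl⟩ := hx
  have hl : l = 1 := by simpa [singleHom] using hz
  rw [hl, map_one]

/-- **Statement 13.** Let `Λ` be a group, `Z` an infinite group and `Γ = Λ ≀ Z`. Then
`Λ_e` is unconfined in `Γ`; in fact the conjugating element can be taken in `Z`: for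
every finite `E ⊆ Γ` with `1 ∉ E` there is `z ∈ Z` with `z·Λ_e·z⁻¹ ∩ E = ∅`, i.e.
`z⁻¹·x·z ∉ Λ_e` for all `x ∈ E`. -/
theorem lambda_e_unconfined_in_wreath (Λ Z : Type*) [Group Λ] [Group Z] [Infinite Z] :
    ∀ E : Finset (Wr Λ Z), (1 : Wr Λ Z) ∉ E →
      (∃ γ : Wr Λ Z, ∀ x ∈ E, γ⁻¹ * x * γ ∉ LambdaAt Λ Z (1 : Z)) ∧
      (∃ z : Z, ∀ x ∈ E,
        (SemidirectProduct.inr z : Wr Λ Z)⁻¹ * x * SemidirectProduct.inr z ∉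
          LambdaAt Λ Z (1 : Z)) := by
  intro E hE
  have hfin : (⋃ x ∈ E, Function.mulSupport x.left.1).Finite :=
    E.finite_toSet.biUnion fun x _ => x.left.2
  obtain ⟨z, hz⟩ := hfin.exists_notMem
  have key : ∀ x ∈ E, (SemidirectProduct.inr z : Wr Λ Z)⁻¹ * x * SemidirectProduct.inr z ∉
      LambdaAt Λ Z (1 : Z) := by
    intro x hx hmem
    rw [conj_inr_mem_LambdaAt_one_iff] at hmem
    have hxz : x.left.1 z = 1 := by
      by_contra h
      exact hz (Set.mem_biUnion hx h)
    exact hE (eq_one_of_mem_LambdaAt Λ Z hmem hxz ▸ hx)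
  exact ⟨⟨_, key⟩, z, key⟩

end
end

section
/- Let L be a group that is not amenable, acting on a set X, and let μ be an L-invariant mean on X. Then μ(F) = 0, where F = {x ∈ X : l·x ≠ x for all l ∈ L with l ≠ 1} is the union of the free (regular) L-orbits in X. -/
/-- A mean on a set `X`: a finitely additive probability "measure" defined on all
subsets of `X`. -/
structure IsMean {X : Type*} (μ : Set X → ℝ) : Prop where
  nonneg : ∀ A : Set X, 0 ≤ μ A
  total : μ Set.univ = 1
  additive : ∀ A B : Set X, A ∩ B = ∅ → μ (A ∪ B) = μ A + μ B

/-- A group `L` is amenable if it carries a left-invariant mean. -/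
def IsAmenableGroup (L : Type*) [Group L] : Prop :=
  ∃ m : Set L → ℝ, IsMean m ∧ ∀ (g : L) (A : Set L), m ((g * ·) '' A) = m A

/-- The free part of an action admits an equivariant map to the acting group. -/
theorem exists_equivariant_map_on_free_part (L X : Type*) [Group L] [MulAction L X] :
    ∃ φ : X → L, ∀ (g : L) (x : X), (∀ l : L, l ≠ 1 → l • x ≠ x) → φ (g • x) = g * φ x := by
  let r : X → X := fun x => (Quotient.mk (MulAction.orbitRel L X) x).out
  have hr : ∀ x, ∃ l : L, l • r x = x := fun x =>
    MulAction.mem_orbit_symm.mp (MulAction.orbitRel_apply.mp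
      (Quotient.mk_out (s := MulAction.orbitRel L X) x))
  have hrg : ∀ (g : L) (x : X), r (g • x) = r x := fun g x =>
    congrArg Quotient.out (Quotient.sound (s := MulAction.orbitRel L X)
      (MulAction.orbitRel_apply.mpr (MulAction.mem_orbit x g)))
  choose φ hφ using hr
  refine ⟨φ, fun g x hx => ?_⟩
  have hsmul : φ (g • x) • r x = g • x := by rw [← hrg g x, hφ]
  have hrx : r x = (φ x)⁻¹ • x := eq_inv_smul_iff.mpr (hφ x)
  rw [hrx, smul_smul] at hsmul
  have hfix : (g⁻¹ * (φ (g • x) * (φ x)⁻¹)) • x = x := by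
    rw [mul_smul, hsmul, inv_smul_smul]
  have hone := not_not.mp fun h => hx _ h hfix
  exact mul_inv_eq_iff_eq_mul.mp (inv_mul_eq_one.mp hone).symm

/-- The image under `g` of a free point is free. -/
theorem smul_free_of_free {L X : Type*} [Group L] [MulAction L X] (g : L) {x : X}
    (hx : ∀ l : L, l ≠ 1 → l • x ≠ x) : ∀ l : L, l ≠ 1 → l • g • x ≠ g • x := by
  intro l hl h
  refine hx (g⁻¹ * l * g) (fun h1 => hl ?_) ?_
  · simpa using conj_eq_one_iff (a := g⁻¹) (b := l) |>.mp (by simpa using h1)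
  · rw [mul_smul, mul_smul, h, inv_smul_smul]

/-- **Statement 15.** Let `L` be a non-amenable group acting on a set `X` and `μ` an
`L`-invariant mean on `X`. Then `μ(F) = 0`, where `F` is the union of the free
(regular) `L`-orbits. -/
theorem invariant_mean_vanishes_on_free_part {L X : Type*} [Group L] [MulAction L X]
    (hL : ¬ IsAmenableGroup L)
    (μ : Set X → ℝ) (hμ : IsMean μ)
    (hinv : ∀ (g : L) (A : Set X), μ ((g • ·) '' A) = μ A) :
    μ {x : X | ∀ l : L, l ≠ 1 → l • x ≠ x} = 0 := by
  by_contra hF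
  obtain ⟨φ, hφ⟩ := exists_equivariant_map_on_free_part L X
  set F : Set X := {x : X | ∀ l : L, l ≠ 1 → l • x ≠ x}
  refine hL ⟨fun A => μ (F ∩ φ ⁻¹' A) / μ F, ⟨fun A => ?_, ?_, fun A B hAB => ?_⟩, fun g A => ?_⟩
  · exact div_nonneg (hμ.nonneg _) (hμ.nonneg _)
  · simp [div_self hF]
  · have hdisj : (F ∩ φ ⁻¹' A) ∩ (F ∩ φ ⁻¹' B) = ∅ := by
      rw [← Set.inter_inter_distrib_left, ← Set.preimage_inter, hAB, Set.preimage_empty,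
        Set.inter_empty]
    rw [Set.preimage_union, Set.inter_union_distrib_left, hμ.additive _ _ hdisj, add_div]
  · have himage : F ∩ φ ⁻¹' ((g * ·) '' A) = (g • ·) '' (F ∩ φ ⁻¹' A) := by
      ext x
      constructor
      · rintro ⟨hx, a, ha, hax : g * a = φ x⟩
        refine ⟨g⁻¹ • x, ⟨smul_free_of_free g⁻¹ hx, ?_⟩, smul_inv_smul g x⟩
        rwa [Set.mem_preimage, hφ _ _ hx, ← hax, inv_mul_cancel_left]
      · rintro ⟨y, ⟨hy, hyA⟩, rfl⟩
        exact ⟨smul_free_of_free g hy, φ y, hyA, (hφ g y hy).symm⟩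
    simp only [himage, hinv]
end

section
/- Let Λ be a non-amenable group and Z a nontrivial group, and let Γ = Λ ≀ Z be the restricted wreath product. Then Λ_e is not co-amenable in Γ: there is no Γ-invariant mean on the coset space Γ/Λ_e. -/
open scoped Classical

noncomputable section

variable (Λ Z : Type*) [Group Λ] [Group Z]

/-- If `L` acts on `X` preserving a mean, and an invariant set of positive mean maps
`L`-equivariantly to `L`, then `L` is amenable. -/
theorem IsMean.isAmenableGroup_of_equivariant {L X : Type*} [Group L] [MulAction L X]
    {μ : Set X → ℝ} (hμ : IsMean μ)
    (hinv : ∀ (g : L) (A : Set X), μ ((g • ·) '' A) = μ A) {S : Set X}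
    (hS : ∀ (g : L), ∀ x ∈ S, g • x ∈ S) {f : X → L}
    (hf : ∀ (g : L), ∀ x ∈ S, f (g • x) = g * f x) (hpos : 0 < μ S) :
    IsAmenableGroup L := by
  refine ⟨fun A => μ (S ∩ f ⁻¹' A) / μ S, ⟨fun A => ?_, ?_, fun A B hAB => ?_⟩, fun g A => ?_⟩
  · exact div_nonneg (hμ.nonneg _) hpos.le
  · simp [hpos.ne']
  · rw [Set.preimage_union, Set.inter_union_distrib_left, hμ.additive, add_div]
    rw [← Set.inter_inter_distrib_left, ← Set.preimage_inter, hAB, Set.preimage_empty,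
      Set.inter_empty]
  · have key : S ∩ f ⁻¹' ((g * ·) '' A) = (g • ·) '' (S ∩ f ⁻¹' A) := by
      ext x
      constructor
      · rintro ⟨hx, a, ha, hax⟩
        refine ⟨g⁻¹ • x, ⟨hS _ _ hx, ?_⟩, smul_inv_smul g x⟩
        have hax' : g * a = f x := hax
        rw [Set.mem_preimage, hf _ _ hx, ← hax', inv_mul_cancel_left]
        exact ha
      · rintro ⟨y, ⟨hy, hyA⟩, rfl⟩
        exact ⟨hS _ _ hy, f y, hyA, (hf g y hy).symm⟩
    simp only [key, hinv]

/-- A mean is monotone. -/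
theorem IsMean.mono {X : Type*} {μ : Set X → ℝ} (hμ : IsMean μ) {A B : Set X} (h : A ⊆ B) :
    μ A ≤ μ B := by
  have hadd := hμ.additive A (B \ A) (Set.inter_sdiff_self A B)
  rw [Set.union_sdiff_cancel h] at hadd
  linarith [hμ.nonneg (B \ A)]

/-- The `Z`-component of a coset of `Λ_e`. -/
def cosetPosition : Wr Λ Z ⧸ LambdaAt Λ Z (1 : Z) → Z :=
  Quotient.lift (fun γ : Wr Λ Z => γ.right) fun a b hab => by
    obtain ⟨l, hl⟩ := QuotientGroup.leftRel_apply.mp hab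
    obtain rfl : b = a * SemidirectProduct.inl (singleHom Λ Z 1 l) :=
      (eq_mul_of_inv_mul_eq hl.symm)
    simp

/-- The value at `w` of the base component of a coset of `Λ_e` whose `Z`-component is not `w`
(and `1` on the other cosets). -/
def cosetCoord (w : Z) : Wr Λ Z ⧸ LambdaAt Λ Z (1 : Z) → Λ :=
  Quotient.lift (fun γ : Wr Λ Z => if γ.right = w then 1 else γ.left.1 w) fun a b hab => by
    obtain ⟨l, hl⟩ := QuotientGroup.leftRel_apply.mp hab
    obtain rfl : b = a * SemidirectProduct.inl (singleHom Λ Z 1 l) :=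
      (eq_mul_of_inv_mul_eq hl.symm)
    by_cases h : a.right = w
    · simp [h]
    · have h' : ¬ a.right⁻¹ * w = 1 := fun h0 => h (inv_mul_eq_one.mp h0)
      have hs : (shiftHom Λ Z a.right (singleHom Λ Z 1 l)).1 w = 1 := if_neg h'
      simp [h, hs]

/-- If `Λ` is not amenable, an invariant mean on `Γ/Λ_e` gives no mass to the cosets whose
`Z`-component differs from `w`: on these, `Λ_w` acts freely through the coordinate at `w`. -/
theorem measure_cosetPosition_ne_eq_zero {Λ Z : Type*} [Group Λ] [Group Z]
    (hΛ : ¬ IsAmenableGroup Λ) {μ : Set (Wr Λ Z ⧸ LambdaAt Λ Z (1 : Z)) → ℝ} (hμ : IsMean μ)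
    (hinv : ∀ (γ : Wr Λ Z) (A : Set (Wr Λ Z ⧸ LambdaAt Λ Z (1 : Z))),
      μ ((γ • ·) '' A) = μ A) (w : Z) :
    μ {x | cosetPosition Λ Z x ≠ w} = 0 := by
  by_contra hne
  let φ : Λ →* Wr Λ Z := SemidirectProduct.inl.comp (singleHom Λ Z w)
  let _ : MulAction Λ (Wr Λ Z ⧸ LambdaAt Λ Z (1 : Z)) := MulAction.compHom _ φ
  refine hΛ (hμ.isAmenableGroup_of_equivariant (fun g A => hinv (φ g) A)
    (S := {x | cosetPosition Λ Z x ≠ w}) (f := cosetCoord Λ Z w) ?_ ?_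
    (lt_of_le_of_ne (hμ.nonneg _) (Ne.symm hne)))
  · rintro g ⟨γ⟩ hx
    change (φ g * γ).right ≠ w
    have hγ : γ.right ≠ w := hx
    simpa [φ] using hγ
  · rintro g ⟨γ⟩ hx
    have hγ : γ.right ≠ w := hx
    change (if (φ g * γ).right = w then 1 else (φ g * γ).left.1 w) =
      g * (if γ.right = w then 1 else γ.left.1 w)
    simp [φ, hγ, singleHom]

/-- **Statement 16.** Let `Λ` be a non-amenable group, `Z` a nontrivial group and
`Γ = Λ ≀ Z`. Then `Λ_e` is not co-amenable in `Γ`: there is no `Γ`-invariant mean on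
the coset space `Γ/Λ_e`. -/
theorem lambda_e_not_coamenable (Λ Z : Type*) [Group Λ] [Group Z] [Nontrivial Z]
    (hΛ : ¬ IsAmenableGroup Λ) :
    ¬ ∃ μ : Set (Wr Λ Z ⧸ LambdaAt Λ Z (1 : Z)) → ℝ, IsMean μ ∧
        ∀ (γ : Wr Λ Z) (A : Set (Wr Λ Z ⧸ LambdaAt Λ Z (1 : Z))),
          μ ((γ • ·) '' A) = μ A := by
  rintro ⟨μ, hμ, hinv⟩
  obtain ⟨w, hw⟩ := exists_ne (1 : Z)
  have h₁ := measure_cosetPosition_ne_eq_zero hΛ hμ hinv 1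
  have h₂ := measure_cosetPosition_ne_eq_zero hΛ hμ hinv w
  have hsub : {x | cosetPosition Λ Z x ≠ 1}ᶜ ⊆ {x | cosetPosition Λ Z x ≠ w} := by
    intro x hx hxw
    exact hx fun hx1 => hw (hxw.symm.trans hx1)
  have hadd := hμ.additive _ _ (Set.inter_compl_self {x | cosetPosition Λ Z x ≠ 1})
  rw [Set.union_compl_self, hμ.total] at hadd
  linarith [hμ.mono hsub]

end
end
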